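/- (Vcd lower bound) Out(F_n; A_1, …, A_k) contains a free abelian subgroup of rank 2n - 2s(1) - ⋯ - 2s(k) + 2k - 2 - m, where m = #{j : s(j) = 1}; hence vcd(Out(F_n; A_1, …, A_k)) ≥ 2n - 2∑s(j) + 2k - 2 - m. -/

import Mathlib

/-- The subgroup of inner automorphisms of a group. -/
def innAut (G : Type*) [Group G] : Subgroup (MulAut G) :=
  (MulAut.conj : G →* MulAut G).range

instance innAut_normal (G : Type*) [Group G] : (innAut G).Normal := by
  constructor
  intro f hf h
  obtain ⟨g, rfl⟩ := hf
  refine ⟨h g, ?_⟩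
  ext x
  simp [MulAut.conj_apply, map_mul, map_inv, mul_assoc]

/-- The group of automorphisms of `G` whose restriction to each subgroup `A i`
is conjugation by some element of `G`. -/
def relAut {G : Type*} [Group G] {ι : Type*} (A : ι → Subgroup G) : Subgroup (MulAut G) where
  carrier := {f | ∀ i, ∃ g : G, ∀ x ∈ A i, f x = g * x * g⁻¹}
  one_mem' := fun i => ⟨1, by simp⟩
  mul_mem' := by
    intro f₁ f₂ h₁ h₂ i
    obtain ⟨g₂, hg₂⟩ := h₂ i
    obtain ⟨g₁, hg₁⟩ := h₁ i
    refine ⟨f₁ g₂ * g₁, fun x hx => ?_⟩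
    have : (f₁ * f₂) x = f₁ (f₂ x) := rfl
    rw [this, hg₂ x hx, map_mul, map_mul, map_inv, hg₁ x hx]
    group
  inv_mem' := by
    intro f hf i
    obtain ⟨g, hg⟩ := hf i
    refine ⟨(f⁻¹ g)⁻¹, fun x hx => ?_⟩
    apply f.injective
    have h1 : f (f⁻¹ x) = x := f.apply_symm_apply x
    simp only [map_mul, map_inv]
    rw [show f (f⁻¹ x) = x from f.apply_symm_apply x,
        show f (f⁻¹ g) = g from f.apply_symm_apply g, hg x hx]
    group

section Model
/-- Free basis: generators `y_p^j` (`j < k`, `p < s j`) and `x_i` (`i < N`). -/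
abbrev RBasis (k N : ℕ) (s : Fin k → ℕ) : Type := (Σ j : Fin k, Fin (s j)) ⊕ Fin N

/-- The free group `F_n` on that basis, `n = s 1 + ⋯ + s k + N`. -/
abbrev RF (k N : ℕ) (s : Fin k → ℕ) : Type := FreeGroup (RBasis k N s)

variable {k N : ℕ} {s : Fin k → ℕ}

/-- The generator `y_p^j`. -/
def yg (j : Fin k) (p : Fin (s j)) : RF k N s := FreeGroup.of (Sum.inl ⟨j, p⟩)

/-- The generator `x_i`. -/
def xg (i : Fin N) : RF k N s := FreeGroup.of (Sum.inr i)

/-- The free factor `A_j = ⟨y_1^j, …, y_{s(j)}^j⟩`. -/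
def factor (j : Fin k) : Subgroup (RF k N s) := Subgroup.closure (Set.range fun p => yg (N := N) j p)

/-- The endomorphism conjugating the generators of the `j`-th block by `g`
and fixing all other basis elements. -/
def conjBlockHom (g : RF k N s) (j : Fin k) : RF k N s →* RF k N s :=
  FreeGroup.lift fun t => match t with
    | Sum.inl ⟨j', p⟩ =>
        if j' = j then g * FreeGroup.of (Sum.inl ⟨j', p⟩) * g⁻¹
        else FreeGroup.of (Sum.inl ⟨j', p⟩)
    | Sum.inr i => FreeGroup.of (Sum.inr i)

/-- The endomorphism `x_i ↦ g * x_i`, fixing all other basis elements. -/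
def leftMulHom (g : RF k N s) (i : Fin N) : RF k N s →* RF k N s :=
  FreeGroup.lift fun t => match t with
    | Sum.inr i' => if i' = i then g * FreeGroup.of (Sum.inr i') else FreeGroup.of (Sum.inr i')
    | t => FreeGroup.of t

/-- The endomorphism `x_i ↦ x_i * g⁻¹`, fixing all other basis elements. -/
def rightMulInvHom (g : RF k N s) (i : Fin N) : RF k N s →* RF k N s :=
  FreeGroup.lift fun t => match t with
    | Sum.inr i' => if i' = i then FreeGroup.of (Sum.inr i') * g⁻¹ else FreeGroup.of (Sum.inr i')
    | t => FreeGroup.of t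

variable (hk : 0 < k) (hs : ∀ j, 0 < s j)

/-- The element `y_1^1`. -/
def y11 (hk : 0 < k) (hs : ∀ j, 0 < s j) : RF k N s := yg ⟨0, hk⟩ ⟨0, hs _⟩

/-- `α_i : x_i ↦ y_1^1 x_i`. -/
def alphaHom (i : Fin N) : RF k N s →* RF k N s := leftMulHom (y11 hk hs) i

/-- `β_i : x_i ↦ x_i (y_1^1)⁻¹`. -/
def betaHom (i : Fin N) : RF k N s →* RF k N s := rightMulInvHom (y11 hk hs) i

/-- `γ_j`: conjugation of the `j`-th block by `y_1^1`. -/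
def gammaHom (j : Fin k) : RF k N s →* RF k N s := conjBlockHom (y11 hk hs) j

/-- `δ_j`: conjugation of the `j`-th block by `y_1^j`. -/
def deltaHom (j : Fin k) : RF k N s →* RF k N s := conjBlockHom (yg j ⟨0, hs j⟩) j

end Model

/-- The integral Heisenberg group. -/
@[ext] structure HeisZ where
  a : ℤ
  b : ℤ
  c : ℤ

namespace HeisZ

instance : Mul HeisZ := ⟨fun x y => ⟨x.a + y.a, x.b + y.b, x.c + y.c + x.a * y.b⟩⟩
instance : One HeisZ := ⟨⟨0, 0, 0⟩⟩
instance : Inv HeisZ := ⟨fun x => ⟨-x.a, -x.b, -x.c + x.a * x.b⟩⟩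

@[simp] theorem mul_a (x y : HeisZ) : (x * y).a = x.a + y.a := rfl
@[simp] theorem mul_b (x y : HeisZ) : (x * y).b = x.b + y.b := rfl
@[simp] theorem mul_c (x y : HeisZ) : (x * y).c = x.c + y.c + x.a * y.b := rfl
@[simp] theorem one_a : (1 : HeisZ).a = 0 := rfl
@[simp] theorem one_b : (1 : HeisZ).b = 0 := rfl
@[simp] theorem one_c : (1 : HeisZ).c = 0 := rfl
@[simp] theorem inv_a (x : HeisZ) : (x⁻¹).a = -x.a := rfl
@[simp] theorem inv_b (x : HeisZ) : (x⁻¹).b = -x.b := rfl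
@[simp] theorem inv_c (x : HeisZ) : (x⁻¹).c = -x.c + x.a * x.b := rfl

instance : Group HeisZ := Group.ofLeftAxioms
  (by intro x y z; ext <;> simp <;> ring)
  (by intro x; ext <;> simp)
  (by intro x; ext <;> simp)

/-- Projection to the first coordinate. -/
def projA : HeisZ →* Multiplicative ℤ where
  toFun x := Multiplicative.ofAdd x.a
  map_one' := rfl
  map_mul' _ _ := rfl

end HeisZ

section Expo
variable {T : Type*} [DecidableEq T]

/-- Exponent sum of the generator `u`. -/
def expo (u : T) : FreeGroup T →* Multiplicative ℤ :=
  FreeGroup.lift fun t => Multiplicative.ofAdd (if t = u then 1 else 0)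

theorem expo_of_self (u : T) : expo u (FreeGroup.of u) = Multiplicative.ofAdd 1 := by
  simp [expo]

theorem expo_of_ne {u t : T} (h : t ≠ u) : expo u (FreeGroup.of t) = 1 := by
  simp [expo, h]

/-- The Heisenberg test map. -/
def heis (u w : T) : FreeGroup T →* HeisZ :=
  FreeGroup.lift fun t => ⟨if t = u then 1 else 0, if t = w then 1 else 0, 0⟩

theorem heis_a (u w : T) (g : FreeGroup T) :
    (heis u w g).a = Multiplicative.toAdd (expo u g) := by
  have : HeisZ.projA.comp (heis u w) = expo u := by
    ext t
    simp [heis, expo, HeisZ.projA]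
  rw [← this]; rfl

theorem expo_eq_of_conj {u w : T} (hne : w ≠ u) {g h : FreeGroup T}
    (H : g * FreeGroup.of w * g⁻¹ = h * FreeGroup.of w * h⁻¹) : expo u g = expo u h := by
  have H1 := congrArg (fun z => (heis u w z).c) H
  have e : heis u w (FreeGroup.of w) = ⟨0, 1, 0⟩ := by simp [heis, hne]
  simp only [map_mul, map_inv, e, HeisZ.mul_c, HeisZ.mul_a, HeisZ.inv_c, HeisZ.inv_b, heis_a] at H1
  apply Multiplicative.toAdd.injective
  linarith
end Expo

section Endo
variable {k N : ℕ} {s : Fin k → ℕ}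

/-- Index type for the commuting automorphisms. -/
abbrev GenIx (k N : ℕ) : Type := (Fin N ⊕ Fin N) ⊕ (Fin k ⊕ Fin k)

/-- The conjugator on the `j`-th block. -/
def cj (hk : 0 < k) (hs : ∀ j, 0 < s j) (v : GenIx k N → ℤ) (j : Fin k) : RF k N s :=
  y11 hk hs ^ v (.inr (.inl j)) * yg j ⟨0, hs j⟩ ^ v (.inr (.inr j))

/-- The endomorphism attached to an integer vector. -/
def endo (hk : 0 < k) (hs : ∀ j, 0 < s j) (v : GenIx k N → ℤ) : RF k N s →* RF k N s :=
  FreeGroup.lift fun t => match t with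
    | Sum.inl ⟨j, p⟩ => cj hk hs v j * yg j p * (cj hk hs v j)⁻¹
    | Sum.inr i => y11 hk hs ^ v (.inl (.inl i)) * xg i * (y11 hk hs ^ v (.inl (.inr i)))⁻¹

variable (hk : 0 < k) (hs : ∀ j, 0 < s j)

theorem endo_yg (v : GenIx k N → ℤ) (j : Fin k) (p : Fin (s j)) :
    endo hk hs v (yg j p) = cj hk hs v j * yg j p * (cj hk hs v j)⁻¹ := by
  simp [endo, yg]

theorem endo_xg (v : GenIx k N → ℤ) (i : Fin N) :
    endo hk hs v (xg i) =
      y11 hk hs ^ v (.inl (.inl i)) * xg i * (y11 hk hs ^ v (.inl (.inr i)))⁻¹ := by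
  simp [endo, xg]

theorem endo_y11 (v : GenIx k N → ℤ) :
    endo hk hs v (y11 hk hs) = y11 hk hs := by
  have h := endo_yg hk hs v ⟨0, hk⟩ ⟨0, hs _⟩
  have h2 : cj hk hs v ⟨0, hk⟩ = y11 hk hs ^ (v (.inr (.inl ⟨0, hk⟩)) + v (.inr (.inr ⟨0, hk⟩))) := by
    rw [zpow_add]; rfl
  rw [h2] at h
  change endo hk hs v (y11 hk hs) = _ * y11 hk hs * _ at h
  rw [h]
  generalize y11 hk hs = y
  group

theorem endo_yg0 (v : GenIx k N → ℤ) (j : Fin k) :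
    endo hk hs v (yg j ⟨0, hs j⟩) = y11 hk hs ^ v (.inr (.inl j)) * yg j ⟨0, hs j⟩ *
      (y11 hk hs ^ v (.inr (.inl j)))⁻¹ := by
  rw [endo_yg, cj]
  group

theorem endo_cj (v w : GenIx k N → ℤ) (j : Fin k) :
    endo hk hs v (cj hk hs w j) * cj hk hs v j = cj hk hs (v + w) j := by
  have h : endo hk hs v (cj hk hs w j) = y11 hk hs ^ w (.inr (.inl j)) *
      (y11 hk hs ^ v (.inr (.inl j)) * yg j ⟨0, hs j⟩ ^ w (.inr (.inr j)) *
      (y11 hk hs ^ v (.inr (.inl j)))⁻¹) := by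
    rw [cj, map_mul, map_zpow, map_zpow, endo_y11, endo_yg0, conj_zpow]
  rw [h, cj, cj, Pi.add_apply, Pi.add_apply, add_comm (v _) (w _), zpow_add, add_comm (v _) (w _), zpow_add]
  group

theorem endo_add (v w : GenIx k N → ℤ) :
    endo hk hs (v + w) = (endo hk hs v).comp (endo hk hs w) := by
  ext t
  rcases t with ⟨j, p⟩ | i
  · change endo hk hs (v + w) (yg j p) = endo hk hs v (endo hk hs w (yg j p))
    rw [endo_yg, endo_yg, map_mul, map_mul, map_inv, endo_yg, ← endo_cj]
    group
  · change endo hk hs (v + w) (xg i) = endo hk hs v (endo hk hs w (xg i))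
    rw [endo_xg, endo_xg, map_mul, map_mul, map_inv, map_zpow, map_zpow, endo_y11, endo_xg,
      Pi.add_apply, Pi.add_apply, add_comm (v _) (w _), zpow_add, zpow_add]
    group

theorem endo_zero : endo hk hs (0 : GenIx k N → ℤ) = MonoidHom.id (RF k N s) := by
  ext t
  rcases t with ⟨j, p⟩ | i
  · change endo hk hs 0 (yg j p) = yg j p
    simp [endo_yg, cj]
  · change endo hk hs 0 (xg i) = xg i
    simp [endo_xg]

/-- The automorphism attached to an integer vector. -/
def autHom : Multiplicative (GenIx k N → ℤ) →* MulAut (RF k N s) where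
  toFun v := MonoidHom.toMulEquiv (endo hk hs v.toAdd) (endo hk hs (-v.toAdd))
    (by rw [← endo_add, neg_add_cancel, endo_zero])
    (by rw [← endo_add, add_neg_cancel, endo_zero])
  map_one' := by
    ext x
    change endo hk hs 0 x = x
    rw [endo_zero]; rfl
  map_mul' v w := by
    ext x
    change endo hk hs (v.toAdd + w.toAdd) x = endo hk hs v.toAdd (endo hk hs w.toAdd x)
    rw [endo_add]; rfl

theorem autHom_apply (v : Multiplicative (GenIx k N → ℤ)) (x : RF k N s) :
    autHom hk hs v x = endo hk hs v.toAdd x := rfl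

theorem autHom_mem (v : Multiplicative (GenIx k N → ℤ)) :
    autHom hk hs v ∈ relAut fun j : Fin k => factor (s := s) (N := N) j := by
  intro j
  refine ⟨cj hk hs v.toAdd j, fun x hx => ?_⟩
  have : Set.EqOn (endo hk hs v.toAdd) (MulAut.conj (cj hk hs v.toAdd j)).toMonoidHom
      (Subgroup.closure (Set.range fun p => yg (N := N) j p) : Subgroup (RF k N s)) := by
    apply MonoidHom.eqOn_closure
    rintro _ ⟨p, rfl⟩
    simp [endo_yg]
  exact this hx

/-- The allowed coordinates. -/
def good (hk : 0 < k) (s : Fin k → ℕ) : Finset (GenIx k N) :=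
  Finset.univ.disjSum ((Finset.univ.erase ⟨0, hk⟩).disjSum (Finset.univ.filter fun j => s j ≠ 1))

/-- The weight of a coordinate. -/
def wt (hk : 0 < k) : GenIx k N → ℤ
  | .inl _ => 1
  | .inr (.inl _) => 1
  | .inr (.inr j) => if j = ⟨0, hk⟩ then 1 else 0

theorem kernel_desc (v : GenIx k N → ℤ) (hv : ∀ e, e ∉ good hk s → v e = 0) (g : RF k N s)
    (hg : ∀ x, endo hk hs v x = g * x * g⁻¹) :
    ∃ t : ℤ, ∀ e ∈ good hk s, v e = t * wt hk e := by
  set y : RBasis k N s := Sum.inl ⟨⟨0, hk⟩, ⟨0, hs _⟩⟩ with hy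
  have hy11 : y11 hk hs = FreeGroup.of y := rfl
  have hself : expo y (y11 hk hs) = Multiplicative.ofAdd 1 := expo_of_self y
  refine ⟨(expo y g).toAdd, ?_⟩
  have h0 : ∀ u, u ≠ y → expo u g = 1 := by
    intro u hu
    have h := hg (y11 hk hs)
    rw [endo_y11] at h
    have := expo_eq_of_conj (u := u) (w := y) (g := g) (h := 1) hu.symm (by
      rw [← hy11, ← h]; simp)
    rw [this, map_one]
  have hblock : ∀ j p u, (Sum.inl ⟨j, p⟩ : RBasis k N s) ≠ u →
      expo u g = expo u (y11 hk hs) ^ v (.inr (.inl j)) * 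
        expo u (yg j ⟨0, hs j⟩) ^ v (.inr (.inr j)) := by
    intro j p u hu
    have h := hg (yg j p)
    rw [endo_yg] at h
    have := expo_eq_of_conj (u := u) (w := Sum.inl ⟨j, p⟩) hu h.symm
    rw [this, cj, map_mul, map_zpow, map_zpow]
  have hx : ∀ i, v (.inl (.inl i)) = (expo y g).toAdd ∧ v (.inl (.inr i)) = (expo y g).toAdd := by
    intro i
    have h := hg (xg i)
    rw [endo_xg] at h
    have hxi : expo y (xg (s := s) (k := k) i) = 1 := expo_of_ne (by simp [hy])
    have h1 := congrArg (expo y) h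
    simp only [map_mul, map_inv, map_zpow, hself, hxi] at h1
    have h2 : v (.inl (.inl i)) = v (.inl (.inr i)) := by
      have := congrArg Multiplicative.toAdd h1
      simp at this
      linarith
    rw [← h2] at h ⊢
    have h3 := expo_eq_of_conj (u := y) (w := Sum.inr i) (by simp [hy]) h
    have := congrArg Multiplicative.toAdd h3
    rw [map_zpow, hself] at this
    simp at this
    exact ⟨this, this⟩
  rintro ((i | i) | (j | j)) he
  · simp [wt, (hx i).1]
  · simp [wt, (hx i).2]
  · have hj : j ≠ ⟨0, hk⟩ := by simpa [good] using he
    have hne : ∀ p, (Sum.inl ⟨j, p⟩ : RBasis k N s) ≠ y := by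
      intro p h
      simp only [hy, Sum.inl.injEq, Sigma.mk.injEq] at h
      exact hj h.1
    have h := hblock j ⟨0, hs j⟩ y (hne _)
    have h2 : expo y (yg (N := N) j ⟨0, hs j⟩) = 1 := expo_of_ne (hne _)
    rw [h2, hself] at h
    rw [h]
    simp [wt]
  · have hj : s j ≠ 1 := by simpa [good] using he
    have h1 : 1 < s j := by have := hs j; omega
    set p : Fin (s j) := ⟨1, h1⟩
    have hp : (Sum.inl ⟨j, p⟩ : RBasis k N s) ≠ Sum.inl ⟨j, ⟨0, hs j⟩⟩ := by
      simp [p]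
    have h := hblock j p _ hp
    have h2 : expo (Sum.inl ⟨j, ⟨0, hs j⟩⟩) (yg (N := N) j ⟨0, hs j⟩) = Multiplicative.ofAdd 1 :=
      expo_of_self _
    by_cases h3 : j = ⟨0, hk⟩
    · subst h3
      have hc : v (.inr (.inl ⟨0, hk⟩)) = 0 := hv _ (by simp [good])
      rw [h2, hc] at h
      change expo y g = _ at h
      rw [h]
      simp [wt]
    · have hne : (Sum.inl ⟨j, ⟨0, hs j⟩⟩ : RBasis k N s) ≠ y := by
        intro h
        simp only [hy, Sum.inl.injEq, Sigma.mk.injEq] at h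
        exact h3 h.1
      rw [h0 _ hne, h2, hy11, expo_of_ne hne.symm] at h
      have := congrArg Multiplicative.toAdd h
      simp at this
      simp [wt, h3, ← this]

end Endo

theorem exists_base (k N m : ℕ) (hk : 0 < k) (s : Fin k → ℕ) (hm : m ≤ k)
    (hs : ∀ j, 0 < s j) (hone : ∀ j : Fin k, s j = 1 ↔ k - m ≤ (j : ℕ))
    (hr : 0 < 2 * N + 2 * k - 2 - m) :
    ∃ e0 ∈ good (N := N) hk s, wt hk e0 = 1 := by
  by_cases h : s ⟨0, hk⟩ = 1
  · have h1 := (hone _).1 h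
    simp only at h1
    by_cases hN : 0 < N
    · exact ⟨.inl (.inl ⟨0, hN⟩), by simp [good], rfl⟩
    · have h2 : 1 < k := by omega
      exact ⟨.inr (.inl ⟨1, h2⟩), by simp [good], rfl⟩
  · exact ⟨.inr (.inr ⟨0, hk⟩), by simp [good, h], by simp [wt]⟩

theorem card_good (k N m : ℕ) (hk : 0 < k) (s : Fin k → ℕ)
    (hone : ∀ j : Fin k, s j = 1 ↔ k - m ≤ (j : ℕ)) :
    (good (N := N) hk s).card = (N + N) + ((k - 1) + (k - m)) := by
  have h : (Finset.univ.filter fun j : Fin k => s j ≠ 1) =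
      Finset.univ.filter fun j : Fin k => (j : ℕ) < k - m := by
    ext j
    simp only [Finset.mem_filter, Finset.mem_univ, true_and, ne_eq, hone, not_le]
  rw [good, h]
  simp [Finset.card_disjSum, Fin.card_filter_val_lt]

/-- Vcd lower bound: `Out(F_n; A_1, …, A_k)` contains a free abelian subgroup
of rank `2n - 2∑ s j + 2k - 2 - m`, where `m = #{j : s j = 1}` (arranged to be
the last `m` indices) and `n = ∑ s j + N`; so the rank is `2N + 2k - 2 - m`. -/
theorem stmt_16 (k N m : ℕ) (hk : 0 < k) (s : Fin k → ℕ) (hm : m ≤ k)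
    (hs : ∀ j, 0 < s j)
    (hone : ∀ j : Fin k, s j = 1 ↔ k - m ≤ (j : ℕ)) :
    ∃ H : Subgroup
        (↥(Subgroup.map (QuotientGroup.mk' (innAut (RF k N s)))
          (relAut fun j : Fin k => factor (N := N) j))),
      Nonempty (H ≃* Multiplicative (Fin (2 * N + 2 * k - 2 - m) → ℤ)) := by
  by_cases hr : 0 < 2 * N + 2 * k - 2 - m
  swap
  · have h0 : 2 * N + 2 * k - 2 - m = 0 := by omega
    rw [h0]
    refine ⟨⊥, ⟨?_⟩⟩
    haveI : Unique (Multiplicative (Fin 0 → ℤ)) := ⟨⟨1⟩, fun a => Subsingleton.elim _ _⟩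
    exact MulEquiv.ofUnique
  obtain ⟨e0, he0, hw0⟩ := exists_base k N m hk s hm hs hone hr
  have hcard : ((good (N := N) hk s).erase e0).card = 2 * N + 2 * k - 2 - m := by
    rw [Finset.card_erase_of_mem he0, card_good k N m hk s hone]
    omega
  generalize 2 * N + 2 * k - 2 - m = r at hcard
  let eqv := ((good (N := N) hk s).erase e0).equivFinOfCardEq hcard
  let ι : Fin r → GenIx k N := fun i => (eqv.symm i).1
  have hι : Function.Injective ι := Subtype.val_injective.comp eqv.symm.injective
  have hιmem : ∀ i, ι i ∈ (good (N := N) hk s).erase e0 := fun i => (eqv.symm i).2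
  let ext : (Fin r → ℤ) →+ (GenIx k N → ℤ) :=
    { toFun := fun f => Function.extend ι f 0
      map_zero' := Function.extend_zero ι
      map_add' := fun f g => by
        have := Function.extend_add ι f g 0 0
        simpa using this }
  let θ₀ : Multiplicative (Fin r → ℤ) →* MulAut (RF k N s) :=
    (autHom hk hs).comp (AddMonoidHom.toMultiplicative ext)
  let θ : Multiplicative (Fin r → ℤ) →* 
      ↥(Subgroup.map (QuotientGroup.mk' (innAut (RF k N s)))
          (relAut fun j : Fin k => factor (N := N) j)) :=
    ((QuotientGroup.mk' (innAut (RF k N s))).comp θ₀).codRestrict _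
      (fun f => Subgroup.mem_map_of_mem _ (autHom_mem hk hs _))
  have hinj : Function.Injective θ := by
    rw [injective_iff_map_eq_one]
    intro f hf
    have h1 : QuotientGroup.mk' (innAut (RF k N s)) (θ₀ f) = 1 := congrArg Subtype.val hf
    rw [← MonoidHom.mem_ker, QuotientGroup.ker_mk'] at h1
    obtain ⟨g, hg⟩ := h1
    have hout : ∀ e, e ∉ (good (N := N) hk s).erase e0 → ext f.toAdd e = 0 := by
      intro e he
      refine Function.extend_apply' (f := ι) f.toAdd 0 e ?_
      rintro ⟨i, rfl⟩
      exact he (hιmem i)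
    obtain ⟨t, ht⟩ := kernel_desc hk hs (ext f.toAdd)
      (fun e he => hout e (fun h => he (Finset.mem_of_mem_erase h))) g (fun x => by
        have := DFunLike.congr_fun hg x
        rw [MulAut.conj_apply] at this
        exact this.symm)
    have ht0 : t = 0 := by
      have h := ht e0 he0
      rw [hout e0 (by simp), hw0] at h
      linarith
    apply Multiplicative.toAdd.injective
    funext i
    have h2 := ht (ι i) (Finset.mem_of_mem_erase (hιmem i))
    have h3 : ext f.toAdd (ι i) = f.toAdd i := hι.extend_apply f.toAdd 0 i
    rw [h3, ht0, zero_mul] at h2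
    exact h2
  exact ⟨θ.range, ⟨(MonoidHom.ofInjective hinj).symm⟩⟩
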